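/- arXiv:2406.01119 — 7 statements merged into one kernel-verified Lean document; each statement's English description precedes it below -/
import Mathlib

section
/- For every point v of the box (i.e. every v ∈ ℤ^n with 0 ≤ v_i ≤ a_i for all i), the crossing number M(v) is either 0 or a power of 2; that is, M(v) ∈ {0} ∪ {2^k : k ≥ 0}. -/
/-- The crossing number of a point `v` of the discretized billiard box
`[0, a 1] × … × [0, a n]`: the number of integers `x` with `0 ≤ x ≤ lcm (a 1, …, a n)`
such that for every coordinate `i`, `2 * a i ∣ x - v i` or `2 * a i ∣ x + v i`. -/
noncomputable def crossingNumber (n : ℕ) (a v : Fin n → ℤ) : ℕ :=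
  Nat.card {x : ℤ // 0 ≤ x ∧ x ≤ Finset.univ.lcm a ∧
    ∀ i : Fin n, 2 * a i ∣ x - v i ∨ 2 * a i ∣ x + v i}

/-- One half of the distributivity of `gcd` over `lcm`, on the integers. -/
lemma Int.gcd_lcm_dvd_of_dvd {a b k t : ℤ} (ha : GCDMonoid.gcd a k ∣ t)
    (hb : GCDMonoid.gcd b k ∣ t) : GCDMonoid.gcd (GCDMonoid.lcm a b) k ∣ t := by
  set d := GCDMonoid.gcd (GCDMonoid.lcm a b) k
  have hdk : d ∣ k := gcd_dvd_right _ _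
  have hdl : d ∣ GCDMonoid.lcm a b := gcd_dvd_left _ _
  obtain ⟨a', b', haa, hbb, hcop⟩ := extract_gcd a b
  set g := GCDMonoid.gcd a b
  have hl : GCDMonoid.lcm a b ∣ g * a' * b' := by
    refine _root_.lcm_dvd ?_ ?_
    · rw [haa]; exact Dvd.intro b' rfl
    · rw [hbb]; exact ⟨a', by ring⟩
  have hda : d ∣ a' * t := by
    refine dvd_trans ?_ (mul_dvd_mul_left a' hb)
    refine dvd_trans (GCDMonoid.dvd_gcd ?_ (hdk.mul_left a')) (gcd_mul_left' a' b k).dvd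
    rw [hbb]
    exact (hdl.trans hl).trans ⟨1, by ring⟩
  have hdb : d ∣ b' * t := by
    refine dvd_trans ?_ (mul_dvd_mul_left b' ha)
    refine dvd_trans (GCDMonoid.dvd_gcd ?_ (hdk.mul_left b')) (gcd_mul_left' b' a k).dvd
    rw [haa]
    exact (hdl.trans hl).trans ⟨1, by ring⟩
  obtain ⟨u, w, huw⟩ := (_root_.gcd_dvd_iff_exists a' b' (z := 1)).1 hcop.dvd
  have ht : t = u * (a' * t) + w * (b' * t) := by linear_combination t * huw
  rw [ht]
  exact dvd_add (hda.mul_left u) (hdb.mul_left w)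

lemma Int.gcd_finset_lcm_dvd_of_dvd {ι : Type*} (s : Finset ι) (m : ι → ℤ) {k t : ℤ}
    (h : ∀ i ∈ s, GCDMonoid.gcd (m i) k ∣ t) : GCDMonoid.gcd (s.lcm m) k ∣ t := by
  classical
  induction s using Finset.induction_on with
  | empty => simp
  | insert j s _ ih =>
    rw [Finset.lcm_insert]
    exact Int.gcd_lcm_dvd_of_dvd (h j (Finset.mem_insert_self j s))
      (ih fun i hi => h i (Finset.mem_insert_of_mem hi))

/-- The Chinese remainder theorem for moduli that need not be coprime: a system of congruences
is solvable as soon as the congruences are pairwise compatible. -/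
lemma Int.exists_forall_dvd_sub_of_gcd_dvd {ι : Type*} (s : Finset ι) (m b : ι → ℤ)
    (h : ∀ i ∈ s, ∀ j ∈ s, GCDMonoid.gcd (m i) (m j) ∣ b i - b j) :
    ∃ x, ∀ i ∈ s, m i ∣ x - b i := by
  classical
  induction s using Finset.induction_on with
  | empty => simp
  | insert j s _ ih =>
    obtain ⟨x, hx⟩ := ih fun i hi k hk =>
      h i (Finset.mem_insert_of_mem hi) k (Finset.mem_insert_of_mem hk)
    have hg : GCDMonoid.gcd (s.lcm m) (m j) ∣ x - b j := by
      refine Int.gcd_finset_lcm_dvd_of_dvd s m fun i hi => ?_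
      rw [← sub_add_sub_cancel x (b i) (b j)]
      exact dvd_add ((gcd_dvd_left _ _).trans (hx i hi))
        (h i (Finset.mem_insert_of_mem hi) j (Finset.mem_insert_self j s))
    obtain ⟨p, q, hpq⟩ := (gcd_dvd_iff_exists _ _).1 hg
    refine ⟨x - s.lcm m * p, fun i hi => ?_⟩
    rcases Finset.mem_insert.1 hi with rfl | hi
    · exact ⟨q, by linear_combination hpq⟩
    · rw [sub_right_comm]
      exact dvd_sub (hx i hi) ((Finset.dvd_lcm hi).mul_right p)

/-- If the fibres of a surjection from a group are the left cosets of a subgroup, the size of the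
target divides the order of the group. -/
lemma Subgroup.card_dvd_of_surjective_of_fibers {G X : Type*} [Group G] (K : Subgroup G)
    (f : G → X) (hf : Function.Surjective f) (hK : ∀ a b, f a = f b ↔ a⁻¹ * b ∈ K) :
    Nat.card X ∣ Nat.card G := by
  have e : G ⧸ K ≃ X := (Quotient.congrRight fun a b => by
    rw [QuotientGroup.leftRel_apply, ← hK, Setoid.ker_def]).trans
      (Setoid.quotientKerEquivOfSurjective f hf)
  rw [← Nat.card_congr e]
  exact K.card_quotient_dvd_card

/-- The sign vectors `ε` for which the congruences `y ≡ ε i * x` modulo `m i` are pairwise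
compatible. -/
def compatibleSigns {ι : Type*} (m : ι → ℤ) (x : ℤ) : Subgroup (ι → ℤˣ) where
  carrier := {ε | ∀ i j, GCDMonoid.gcd (m i) (m j) ∣ ε i * x - ε j * x}
  one_mem' := by simp
  mul_mem' {ε δ} hε hδ i j := by
    obtain ⟨c, hc⟩ := hε i j
    obtain ⟨d, hd⟩ := hδ i j
    refine ⟨ε i * d + δ j * c, ?_⟩
    simp only [Pi.mul_apply, Units.val_mul]
    linear_combination (ε i : ℤ) * hd + δ j * hc
  inv_mem' {ε} hε i j := by simpa using hε i j

/-- The sign vectors `ε` acting on the residues of `x` modulo all `m i` as one global sign. -/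
def globalSigns {ι : Type*} (m : ι → ℤ) (x : ℤ) : Subgroup (ι → ℤˣ) where
  carrier := {ε | ∃ σ : ℤˣ, ∀ i, m i ∣ ε i * x - σ * x}
  one_mem' := ⟨1, by simp⟩
  mul_mem' {ε δ} := by
    rintro ⟨σ, hσ⟩ ⟨τ, hτ⟩
    refine ⟨σ * τ, fun i => ?_⟩
    obtain ⟨c, hc⟩ := hσ i
    obtain ⟨d, hd⟩ := hτ i
    refine ⟨ε i * d + τ * c, ?_⟩
    simp only [Pi.mul_apply, Units.val_mul]
    linear_combination (ε i : ℤ) * hd + τ * hc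
  inv_mem' {ε} := by
    rintro ⟨σ, hσ⟩
    exact ⟨σ, fun i => by simpa using hσ i⟩

/-- Every integer is, up to sign, congruent modulo `2 * l` to an element of `[0, l]`. -/
lemma Int.exists_mem_Icc_two_mul_dvd_sub {l : ℤ} (hl : 0 < l) (y : ℤ) :
    ∃ x, 0 ≤ x ∧ x ≤ l ∧ ∃ σ : ℤˣ, 2 * l ∣ x - σ * y := by
  have h0 := Int.emod_nonneg y (show 2 * l ≠ 0 by omega)
  have h1 := Int.emod_lt_of_pos y (show 0 < 2 * l by omega)
  have h2 := Int.emod_add_mul_ediv y (2 * l)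
  rcases le_total (y % (2 * l)) l with h | h
  · exact ⟨y % (2 * l), h0, h, 1, -(y / (2 * l)), by push_cast; linear_combination h2⟩
  · exact ⟨2 * l - y % (2 * l), by omega, by omega, -1, 1 + y / (2 * l), by
      push_cast; linear_combination -h2⟩

/-- The representative in `[0, l]` modulo `2 * l` and up to sign is unique. -/
lemma Int.eq_of_mem_Icc_of_two_mul_dvd_sub {l x y : ℤ} (hx : 0 ≤ x) (hxl : x ≤ l)
    (hy : 0 ≤ y) (hyl : y ≤ l) {σ : ℤˣ} (h : 2 * l ∣ x - σ * y) : x = y := by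
  obtain ⟨c, hc⟩ := h
  rcases Int.units_eq_one_or σ with rfl | rfl <;> push_cast at hc <;>
    rcases lt_trichotomy c 0 with h | rfl | h <;> nlinarith

lemma Finset.two_mul_lcm_dvd {ι : Type*} {s : Finset ι} (hs : s.Nonempty) {a : ι → ℤ} {y : ℤ}
    (h : ∀ i ∈ s, 2 * a i ∣ y) : 2 * s.lcm a ∣ y := by
  obtain ⟨j, hj⟩ := hs
  obtain ⟨z, rfl⟩ := (Dvd.intro (a j) rfl : (2 : ℤ) ∣ 2 * a j).trans (h j hj)
  exact mul_dvd_mul_left 2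
    (Finset.lcm_dvd fun i hi => (mul_dvd_mul_iff_left two_ne_zero).1 (h i hi))

lemma Int.exists_unit_dvd_sub_iff {m x v : ℤ} :
    (∃ σ : ℤˣ, m ∣ x - σ * v) ↔ m ∣ x - v ∨ m ∣ x + v := by
  constructor
  · rintro ⟨σ, hσ⟩
    rcases Int.units_eq_one_or σ with rfl | rfl
    · exact Or.inl (by simpa using hσ)
    · exact Or.inr (by simpa using hσ)
  · rintro (h | h)
    · exact ⟨1, by simpa using h⟩
    · exact ⟨-1, by simpa using h⟩

/-- Congruence up to sign is transitive. -/
lemma Int.dvd_sub_unit_mul_trans {m x y z : ℤ} {σ τ : ℤˣ} (h : m ∣ x - σ * y)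
    (h' : m ∣ y - τ * z) : m ∣ x - (σ * τ : ℤˣ) * z := by
  obtain ⟨c, hc⟩ := h
  obtain ⟨d, hd⟩ := h'
  exact ⟨c + σ * d, by push_cast; linear_combination hc + σ * hd⟩

/-- Congruence up to sign is symmetric. -/
lemma Int.dvd_sub_unit_mul_symm {m x y : ℤ} {σ : ℤˣ} (h : m ∣ x - σ * y) :
    m ∣ y - σ * x := by
  obtain ⟨c, hc⟩ := h
  exact ⟨-σ * c, by linear_combination -(σ : ℤ) * hc - y * Int.units_coe_mul_self σ⟩

/-- A nonzero crossing number divides the number of sign vectors. -/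
lemma crossingNumber_dvd_two_pow (n : ℕ) (hn : 1 ≤ n) (a : Fin n → ℤ) (ha : ∀ i, 0 < a i)
    (v : Fin n → ℤ) (x₀ : ℤ) (hx₀ : ∀ i, 2 * a i ∣ x₀ - v i ∨ 2 * a i ∣ x₀ + v i) :
    crossingNumber n a v ∣ 2 ^ n := by
  set l := Finset.univ.lcm a with hl_def
  have hne : (Finset.univ : Finset (Fin n)).Nonempty := ⟨⟨0, hn⟩, Finset.mem_univ _⟩
  have hl : 0 < l := by
    refine lt_of_le_of_ne ?_ (Ne.symm ?_)
    · exact Int.nonneg_of_normalize_eq_self Finset.normalize_lcm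
    · rw [hl_def, Ne, Finset.lcm_eq_zero_iff]
      rintro ⟨i, -, hi⟩
      exact (ha i).ne' hi
  have hal (i : Fin n) : 2 * a i ∣ 2 * l :=
    mul_dvd_mul_left 2 (Finset.dvd_lcm (Finset.mem_univ i))
  set m : Fin n → ℤ := fun i => 2 * a i
  choose ρ hρ using fun i => Int.exists_unit_dvd_sub_iff.2 (hx₀ i)
  have hrep (ε : compatibleSigns m x₀) : ∃ x : {x : ℤ // 0 ≤ x ∧ x ≤ Finset.univ.lcm a ∧
      ∀ i : Fin n, 2 * a i ∣ x - v i ∨ 2 * a i ∣ x + v i},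
      ∃ σ : ℤˣ, ∀ i, m i ∣ x.1 - (σ * ε.1 i : ℤˣ) * x₀ := by
    obtain ⟨y, hy⟩ := Int.exists_forall_dvd_sub_of_gcd_dvd Finset.univ m
      (fun i => ε.1 i * x₀) fun i _ j _ => ε.2 i j
    obtain ⟨x, h0, hxl, σ, hσ⟩ := Int.exists_mem_Icc_two_mul_dvd_sub hl y
    have hx (i : Fin n) : m i ∣ x - (σ * ε.1 i : ℤˣ) * x₀ :=
      Int.dvd_sub_unit_mul_trans ((hal i).trans hσ) (hy i (Finset.mem_univ i))
    exact ⟨⟨x, h0, hxl, fun i => Int.exists_unit_dvd_sub_iff.1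
      ⟨_, Int.dvd_sub_unit_mul_trans (hx i) (hρ i)⟩⟩, σ, hx⟩
  choose f s hf using hrep
  have heq {x y : {x : ℤ // 0 ≤ x ∧ x ≤ Finset.univ.lcm a ∧
      ∀ i : Fin n, 2 * a i ∣ x - v i ∨ 2 * a i ∣ x + v i}} {σ : ℤˣ}
      (h : ∀ i, m i ∣ x.1 - σ * y.1) : x = y :=
    Subtype.ext (Int.eq_of_mem_Icc_of_two_mul_dvd_sub x.2.1 x.2.2.1 y.2.1 y.2.2.1
      (Finset.two_mul_lcm_dvd hne fun i _ => h i))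
  have hsurj : Function.Surjective f := by
    intro x
    choose τ hτ using fun i => Int.exists_unit_dvd_sub_iff.2 (x.2.2.2 i)
    have hε (i : Fin n) : m i ∣ x.1 - (τ i * ρ i : ℤˣ) * x₀ :=
      Int.dvd_sub_unit_mul_trans (hτ i) (Int.dvd_sub_unit_mul_symm (hρ i))
    let ε : compatibleSigns m x₀ := ⟨fun i => τ i * ρ i, fun i j => by
      obtain ⟨c, hc⟩ := (gcd_dvd_left (m i) (m j)).trans (hε i)
      obtain ⟨d, hd⟩ := (gcd_dvd_right (m i) (m j)).trans (hε j)
      exact ⟨d - c, by linear_combination hd - hc⟩⟩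
    refine ⟨ε, heq (σ := s ε) fun i => ?_⟩
    have h := Int.dvd_sub_unit_mul_trans (hf ε i) (Int.dvd_sub_unit_mul_symm (hε i))
    rwa [mul_assoc, Int.units_mul_self, mul_one] at h
  have hfib (ε δ : compatibleSigns m x₀) :
      f ε = f δ ↔ ε⁻¹ * δ ∈ (globalSigns m x₀).subgroupOf (compatibleSigns m x₀) := by
    rw [Subgroup.mem_subgroupOf]
    constructor
    · intro h
      refine ⟨s ε * s δ, fun i => ?_⟩
      obtain ⟨p, hp⟩ := hf ε i
      obtain ⟨q, hq⟩ := hf δ i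
      rw [h] at hp
      refine ⟨s δ * ε.1 i * (p - q), ?_⟩
      simp only [Subgroup.coe_mul, Subgroup.coe_inv, Pi.mul_apply, Pi.inv_apply,
        Int.units_inv_eq_self, Units.val_mul] at hp hq ⊢
      linear_combination (s δ * ε.1 i : ℤ) * (hp - hq)
        - (ε.1 i * δ.1 i * x₀ : ℤ) * Int.units_coe_mul_self (s δ)
        + (s ε * s δ * x₀ : ℤ) * Int.units_coe_mul_self (ε.1 i)
    · rintro ⟨σ, hσ⟩
      refine heq (σ := s ε * s δ * σ) fun i => ?_
      obtain ⟨p, hp⟩ := hf ε i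
      obtain ⟨q, hq⟩ := hf δ i
      obtain ⟨c, hc⟩ := hσ i
      refine ⟨p - s ε * s δ * σ * q + s ε * δ.1 i * c, ?_⟩
      simp only [Subgroup.coe_mul, Subgroup.coe_inv, Pi.mul_apply, Pi.inv_apply,
        Int.units_inv_eq_self, Units.val_mul] at hp hq hc ⊢
      linear_combination hp - (s ε * s δ * σ : ℤ) * hq + (s ε * δ.1 i : ℤ) * hc
        - (s ε * ε.1 i * x₀ : ℤ) * Int.units_coe_mul_self (δ.1 i)
        - (s ε * σ * δ.1 i * x₀ : ℤ) * Int.units_coe_mul_self (s δ)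
  have hdvd := Subgroup.card_dvd_of_surjective_of_fibers _ f hsurj hfib
  have hcard : Nat.card (Fin n → ℤˣ) = 2 ^ n := by simp
  rw [← hcard]
  exact hdvd.trans (Subgroup.card_subgroup_dvd_card _)

/-- For every point of the box, the crossing number is `0` or a power of `2`. -/
theorem crossingNumber_eq_zero_or_pow_two (n : ℕ) (hn : 1 ≤ n)
    (a : Fin n → ℤ) (ha : ∀ i, 0 < a i)
    (v : Fin n → ℤ) (hv : ∀ i, 0 ≤ v i ∧ v i ≤ a i) :
    crossingNumber n a v = 0 ∨ ∃ k : ℕ, crossingNumber n a v = 2 ^ k := by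
  rcases isEmpty_or_nonempty {x : ℤ // 0 ≤ x ∧ x ≤ Finset.univ.lcm a ∧
    ∀ i : Fin n, 2 * a i ∣ x - v i ∨ 2 * a i ∣ x + v i} with h | ⟨⟨x₀, hx₀⟩⟩
  · exact Or.inl Nat.card_of_isEmpty
  · obtain ⟨k, -, hk⟩ := (Nat.dvd_prime_pow Nat.prime_two).1
      (crossingNumber_dvd_two_pow n hn a ha v x₀ hx₀.2.2)
    exact Or.inr ⟨k, hk⟩
end

section
/- Assume a_1, …, a_n are pairwise coprime. Let v be a point of the box that is not a corner and whose coordinates all have the same parity (all v_i are even or all v_i are odd). Then M(v) = 2^{n−1−|I(v)|}, where I(v) = {i : v_i = 0 or v_i = a_i}. -/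
/-- `x` is congruent to `v i` or to `-v i` modulo `2 * a i` for every `i`. -/
def IsCrossing {n : ℕ} (a v : Fin n → ℤ) (x : ℤ) : Prop :=
  ∀ i, 2 * a i ∣ x - v i ∨ 2 * a i ∣ x + v i

/-- A multiple of `a` in `[0, a]` is one of the endpoints. -/
theorem eq_zero_or_eq_of_dvd_of_mem_Icc {a v : ℤ} (h0 : 0 ≤ v) (h1 : v ≤ a)
    (h : a ∣ v) : v = 0 ∨ v = a := by
  rcases h0.eq_or_lt with h0 | h0
  · exact Or.inl h0.symm
  · exact Or.inr (le_antisymm h1 (Int.le_of_dvd h0 h))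

theorem Finset.lcm_int_pos {n : ℕ} {a : Fin n → ℤ} (ha : ∀ i, 0 < a i) :
    0 < Finset.univ.lcm a := by
  have hne : Finset.univ.lcm a ≠ 0 := by
    rw [Ne, Finset.lcm_eq_zero_iff]
    rintro ⟨i, -, hi⟩
    exact (ha i).ne' hi
  have hnonneg : 0 ≤ Finset.univ.lcm a := by
    rw [← Finset.normalize_lcm, ← Int.abs_eq_normalize]
    exact abs_nonneg _
  omega

namespace IsCrossing

variable {n : ℕ} {a v : Fin n → ℤ} {x y : ℤ}

protected theorem neg (h : IsCrossing a v x) : IsCrossing a v (-x) := fun i ↦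
  (h i).symm.imp (fun h ↦ by simpa [sub_eq_add_neg, add_comm] using h.neg_right)
    (fun h ↦ by simpa [sub_eq_add_neg, add_comm] using h.neg_right)

/-- If the trajectory is at `v` at a time divisible by all the side lengths, `v` is a corner. -/
theorem corner_of_dvd (hv : ∀ i, 0 ≤ v i ∧ v i ≤ a i)
    (h : IsCrossing a v x) (hx : ∀ i, a i ∣ x) (i : Fin n) : v i = 0 ∨ v i = a i := by
  refine eq_zero_or_eq_of_dvd_of_mem_Icc (hv i).1 (hv i).2 ?_
  rcases h i with h | h
  · exact (dvd_sub_right (hx i)).1 ((Dvd.intro_left 2 rfl).trans h)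
  · exact (dvd_add_right (hx i)).1 ((Dvd.intro_left 2 rfl).trans h)

/-- Two crossing times with the same signs are congruent modulo `2 * lcm a`. -/
theorem two_mul_lcm_dvd_sub (hn : 1 ≤ n) (hx : IsCrossing a v x) (hy : IsCrossing a v y)
    (h : ∀ i, ¬(v i = 0 ∨ v i = a i) → (2 * a i ∣ x - v i ↔ 2 * a i ∣ y - v i)) :
    2 * Finset.univ.lcm a ∣ x - y := by
  have key : ∀ i, 2 * a i ∣ x - y := by
    intro i
    have hsub : ∀ {w}, 2 * a i ∣ x - w → 2 * a i ∣ y - w → 2 * a i ∣ x - y :=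
      fun h₁ h₂ ↦ by simpa using dvd_sub h₁ h₂
    by_cases hi : v i = 0 ∨ v i = a i
    · have h2v : 2 * a i ∣ 2 * v i := mul_dvd_mul_left 2 (by rcases hi with hi | hi <;> simp [hi])
      have lift : ∀ {z}, IsCrossing a v z → 2 * a i ∣ z - v i := by
        intro z hz
        rcases hz i with hz | hz
        · exact hz
        · have := dvd_sub hz h2v
          rwa [show z + v i - 2 * v i = z - v i by ring] at this
      exact hsub (lift hx) (lift hy)
    · by_cases hxi : 2 * a i ∣ x - v i
      · exact hsub hxi ((h i hi).1 hxi)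
      · have hyi := fun hy' ↦ hxi ((h i hi).2 hy')
        refine hsub (w := -v i) ?_ ?_
        · simpa using (hx i).resolve_left hxi
        · simpa using (hy i).resolve_left hyi
  obtain ⟨d, hd⟩ : (2 : ℤ) ∣ x - y := (Dvd.intro _ rfl).trans (key ⟨0, hn⟩)
  rw [hd]
  refine mul_dvd_mul_left 2 (Finset.lcm_dvd fun i _ ↦ ?_)
  have := key i
  rw [hd] at this
  exact Int.dvd_of_mul_dvd_mul_left two_ne_zero this

end IsCrossing

/-- For pairwise coprime `a i`, congruences modulo the `2 * a i` whose right-hand sides all have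
the same parity are simultaneously solvable. -/
theorem exists_forall_two_mul_dvd_sub {n : ℕ} {a : Fin n → ℤ}
    (hcop : ∀ i j, i ≠ j → IsCoprime (a i) (a j)) {w : Fin n → ℤ} {p : ℤ}
    (hw : ∀ i, 2 ∣ w i - p) : ∃ x, ∀ i, 2 * a i ∣ x - w i := by
  choose u hu using hw
  obtain ⟨y, hy⟩ := Ideal.exists_forall_sub_mem_ideal
    (I := fun i ↦ Ideal.span {a i})
    (fun i j hij ↦ (Ideal.isCoprime_span_singleton_iff _ _).2 (hcop i j hij)) u
  refine ⟨2 * y + p, fun i ↦ ?_⟩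
  have := mul_dvd_mul_left 2 (Ideal.mem_span_singleton.1 (hy i))
  rwa [show 2 * y + p - w i = 2 * (y - u i) by linear_combination -hu i]

open Classical in
/-- The crossing times in a full period correspond to choices of signs at the non-wall
coordinates of `v`. -/
theorem card_isCrossing_Ioc {n : ℕ} (hn : 1 ≤ n) {a : Fin n → ℤ} (ha : ∀ i, 0 < a i)
    (hcop : ∀ i j, i ≠ j → IsCoprime (a i) (a j))
    {v : Fin n → ℤ} (hv : ∀ i, 0 ≤ v i ∧ v i ≤ a i)
    (hparity : (∀ i, v i % 2 = 0) ∨ (∀ i, v i % 2 = 1)) :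
    ((Finset.Ioc (-Finset.univ.lcm a) (Finset.univ.lcm a)).filter (IsCrossing a v)).card =
      2 ^ (Finset.univ.filter fun i ↦ ¬(v i = 0 ∨ v i = a i)).card := by
  rw [← Finset.card_powerset]
  have hL := Finset.lcm_int_pos ha
  have hdvd : ∀ i, a i ∣ Finset.univ.lcm a := fun i ↦ Finset.dvd_lcm (Finset.mem_univ i)
  set L := Finset.univ.lcm a with hLdef
  refine Finset.card_bij
    (fun x _ ↦ Finset.univ.filter fun i ↦ ¬(v i = 0 ∨ v i = a i) ∧ 2 * a i ∣ x - v i) ?_ ?_ ?_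
  · intro x _
    rw [Finset.mem_powerset]
    exact Finset.monotone_filter_right _ fun i _ h ↦ h.1
  · intro x hx y hy hxy
    simp only [Finset.mem_filter, Finset.mem_Ioc] at hx hy
    have hd : 2 * L ∣ x - y := hx.2.two_mul_lcm_dvd_sub hn hy.2 fun i hi ↦ by
      have := Finset.ext_iff.1 hxy i
      simpa only [Finset.mem_filter, Finset.mem_univ, true_and, hi, not_false_eq_true] using this
    have := Int.eq_zero_of_abs_lt_dvd hd (by rw [abs_lt]; omega)
    omega
  · intro s hs
    obtain ⟨z, hz⟩ := exists_forall_two_mul_dvd_sub hcop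
      (w := fun i ↦ if i ∈ s then v i else -v i) (p := v ⟨0, hn⟩) (fun i ↦ by
        have : v i % 2 = v ⟨0, hn⟩ % 2 := by
          rcases hparity with h | h <;> rw [h, h]
        split_ifs <;> omega)
    obtain ⟨x, ⟨hx₁, hx₂⟩, hxz⟩ : ∃ x, (-L < x ∧ x ≤ L) ∧ 2 * L ∣ x - z := by
      refine ⟨L - (L - z) % (2 * L), ?_, ?_⟩
      · have h₁ := Int.emod_nonneg (L - z) (b := 2 * L) (by omega)
        have h₂ := Int.emod_lt_of_pos (L - z) (b := 2 * L) (by omega)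
        omega
      · have := Int.dvd_self_sub_emod (x := L - z) (m := 2 * L)
        rwa [show L - z - (L - z) % (2 * L) = L - (L - z) % (2 * L) - z by ring] at this
    have hx : ∀ i, 2 * a i ∣ x - if i ∈ s then v i else -v i := fun i ↦ by
      simpa using dvd_add ((mul_dvd_mul_left 2 (hdvd i)).trans hxz) (hz i)
    refine ⟨x, ?_, ?_⟩
    · simp only [Finset.mem_filter, Finset.mem_Ioc]
      refine ⟨⟨hx₁, hx₂⟩, fun i ↦ ?_⟩
      have := hx i
      split_ifs at this
      · exact Or.inl this
      · exact Or.inr (by simpa using this)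
    · ext i
      simp only [Finset.mem_filter, Finset.mem_univ, true_and]
      have hxi := hx i
      constructor
      · rintro ⟨hi, h⟩
        by_contra his
        rw [if_neg his] at hxi
        have h2v := dvd_sub hxi h
        rw [show x - -v i - (x - v i) = 2 * v i by ring] at h2v
        exact hi (eq_zero_or_eq_of_dvd_of_mem_Icc (hv i).1 (hv i).2
          (Int.dvd_of_mul_dvd_mul_left two_ne_zero h2v))
      · intro his
        rw [if_pos his] at hxi
        exact ⟨(Finset.mem_filter.1 (Finset.mem_powerset.1 hs his)).2, hxi⟩

open Classical in
/-- Over a full period, each crossing of a non-corner point is counted twice. -/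
theorem card_isCrossing_Ioc_eq_two_mul {n : ℕ} {a : Fin n → ℤ} (ha : ∀ i, 0 < a i)
    {v : Fin n → ℤ} (hv : ∀ i, 0 ≤ v i ∧ v i ≤ a i)
    (hnotcorner : ¬ ∀ i, v i = 0 ∨ v i = a i) :
    ((Finset.Ioc (-Finset.univ.lcm a) (Finset.univ.lcm a)).filter (IsCrossing a v)).card =
      2 * crossingNumber n a v := by
  have hL := Finset.lcm_int_pos ha
  have hzero : ¬IsCrossing a v 0 := fun h ↦
    hnotcorner (h.corner_of_dvd hv fun _ ↦ dvd_zero _)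
  have hlcm : ¬IsCrossing a v (Finset.univ.lcm a) := fun h ↦
    hnotcorner (h.corner_of_dvd hv fun i ↦ Finset.dvd_lcm (Finset.mem_univ i))
  set L := Finset.univ.lcm a with hLdef
  have hM : crossingNumber n a v = ((Finset.Icc 0 L).filter (IsCrossing a v)).card := by
    rw [crossingNumber, ← Nat.card_eq_finsetCard]
    refine Nat.card_congr (Equiv.subtypeEquivRight fun x ↦ ?_)
    simp only [Finset.mem_filter, Finset.mem_Icc, and_assoc, IsCrossing, hLdef]
  have hneg : (Finset.Ioc (-L) L).filter (IsCrossing a v) =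
      (Finset.Icc 0 L).filter (IsCrossing a v) ∪
        ((Finset.Icc 0 L).filter (IsCrossing a v)).image Neg.neg := by
    ext x
    simp only [Finset.mem_filter, Finset.mem_Ioc, Finset.mem_union, Finset.mem_image,
      Finset.mem_Icc]
    constructor
    · rintro ⟨⟨h₁, h₂⟩, h⟩
      rcases le_or_gt 0 x with hx | hx
      · exact Or.inl ⟨⟨hx, h₂⟩, h⟩
      · exact Or.inr ⟨-x, ⟨⟨by omega, by omega⟩, h.neg⟩, neg_neg x⟩
    · rintro (⟨⟨h₁, h₂⟩, h⟩ | ⟨y, ⟨⟨h₁, h₂⟩, h⟩, rfl⟩)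
      · exact ⟨⟨by omega, h₂⟩, h⟩
      · have hy : y ≠ L := fun hy ↦ hlcm (hy ▸ h)
        exact ⟨⟨by omega, by omega⟩, h.neg⟩
  rw [hneg, Finset.card_union_of_disjoint, Finset.card_image_of_injective _ neg_injective, hM,
    two_mul]
  rw [Finset.disjoint_left]
  intro x hx hx'
  simp only [Finset.mem_filter, Finset.mem_image, Finset.mem_Icc] at hx hx'
  obtain ⟨y, ⟨⟨h₁, -⟩, -⟩, rfl⟩ := hx'
  exact hzero ((show -y = 0 by omega) ▸ hx.2)

/-- For pairwise coprime side lengths and a non-corner point `v` whose coordinates all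
have the same parity, `M(v) = 2 ^ (n - 1 - |I(v)|)` where `I(v) = {i : v i = 0 ∨ v i = a i}`. -/
theorem crossingNumber_eq_of_coprime (n : ℕ) (hn : 1 ≤ n)
    (a : Fin n → ℤ) (ha : ∀ i, 0 < a i)
    (hcop : ∀ i j, i ≠ j → IsCoprime (a i) (a j))
    (v : Fin n → ℤ) (hv : ∀ i, 0 ≤ v i ∧ v i ≤ a i)
    (hnotcorner : ¬ ∀ i, v i = 0 ∨ v i = a i)
    (hparity : (∀ i, v i % 2 = 0) ∨ (∀ i, v i % 2 = 1)) :
    crossingNumber n a v =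
      2 ^ (n - 1 - (Finset.univ.filter (fun i => v i = 0 ∨ v i = a i)).card) := by
  have h := card_isCrossing_Ioc hn ha hcop hv hparity
  rw [card_isCrossing_Ioc_eq_two_mul ha hv hnotcorner] at h
  have hcard := Finset.card_filter_add_card_filter_not (s := Finset.univ)
    (fun i ↦ v i = 0 ∨ v i = a i)
  rw [Finset.card_univ, Fintype.card_fin] at hcard
  have hpos : 0 < (Finset.univ.filter fun i ↦ ¬(v i = 0 ∨ v i = a i)).card := by
    obtain ⟨i, hi⟩ := not_forall.1 hnotcorner
    exact Finset.card_pos.2 ⟨i, Finset.mem_filter.2 ⟨Finset.mem_univ i, hi⟩⟩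
  refine Nat.eq_of_mul_eq_mul_left two_pos ?_
  rw [← pow_succ']
  convert h using 2
  omega
end

section
/- Assume a_1, …, a_n are pairwise coprime. Let v be a point of the box that is not a corner. Then M(v) ≤ 2^{n−1−|I(v)|}, where I(v) = {i : v_i = 0 or v_i = a_i}. -/
/-- If `2 * a i` divides `z` for every `i`, then so does twice the least common multiple. -/
theorem two_mul_lcm_dvd {ι : Type*} [Fintype ι] [Nonempty ι] {a : ι → ℤ} {z : ℤ}
    (h : ∀ i, 2 * a i ∣ z) : 2 * Finset.univ.lcm a ∣ z := by
  obtain ⟨w, rfl⟩ := (dvd_mul_right 2 _).trans (h (Classical.arbitrary ι))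
  exact mul_dvd_mul_left 2
    (Finset.lcm_dvd fun i _ => (mul_dvd_mul_iff_left two_ne_zero).1 (h i))

/-- Two points of `[0, L]` that agree up to sign modulo `2 * L` are equal. -/
theorem eq_of_two_mul_dvd_sub_or_add {L x y : ℤ} (hL : L ≠ 0) (hx : 0 ≤ x) (hxL : x ≤ L)
    (hy : 0 ≤ y) (hyL : y ≤ L) (h : 2 * L ∣ x - y ∨ 2 * L ∣ x + y) : x = y := by
  have hpos : 0 < L := by omega
  rcases h with ⟨c, hc⟩ | ⟨c, hc⟩
  · have h1 : c < 1 := by nlinarith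
    have h2 : -1 < c := by nlinarith
    obtain rfl : c = 0 := by omega
    linarith
  · have h1 : c < 2 := by nlinarith
    have h2 : -1 < c := by nlinarith
    obtain rfl | rfl : c = 0 ∨ c = 1 := by omega
    all_goals linarith

/-- For pairwise coprime side lengths and a non-corner point `v`,
`M(v) ≤ 2 ^ (n - 1 - |I(v)|)` where `I(v) = {i : v i = 0 ∨ v i = a i}`. -/
theorem crossingNumber_le_of_coprime (n : ℕ) (hn : 1 ≤ n)
    (a : Fin n → ℤ) (ha : ∀ i, 0 < a i)
    (hcop : ∀ i j, i ≠ j → IsCoprime (a i) (a j))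
    (v : Fin n → ℤ) (hv : ∀ i, 0 ≤ v i ∧ v i ≤ a i)
    (hnotcorner : ¬ ∀ i, v i = 0 ∨ v i = a i) :
    crossingNumber n a v ≤
      2 ^ (n - 1 - (Finset.univ.filter (fun i => v i = 0 ∨ v i = a i)).card) := by
  classical
  push Not at hnotcorner
  obtain ⟨k, hk⟩ := hnotcorner
  have : Nonempty (Fin n) := ⟨k⟩
  set I := Finset.univ.filter (fun i => v i = 0 ∨ v i = a i) with hI
  have hkI : k ∈ Iᶜ := by simp [hI, hk]
  have hL : Finset.univ.lcm a ≠ 0 := by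
    simpa [Finset.lcm_eq_zero_iff] using fun i => ne_of_gt (ha i)
  -- Record the sign of `x` at each non-degenerate coordinate relative to its sign at `k`.
  let f : {x : ℤ // 0 ≤ x ∧ x ≤ Finset.univ.lcm a ∧
      ∀ i : Fin n, 2 * a i ∣ x - v i ∨ 2 * a i ∣ x + v i} → (Iᶜ.erase k → Bool) :=
    fun x i => decide (2 * a i ∣ x.1 - v i ↔ 2 * a k ∣ x.1 - v k)
  have hf : Function.Injective f := by
    rintro ⟨x, hx0, hxL, hx⟩ ⟨y, hy0, hyL, hy⟩ hxy
    have hrel : ∀ i, i ∉ I → ((2 * a i ∣ x - v i ↔ 2 * a k ∣ x - v k) ↔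
        (2 * a i ∣ y - v i ↔ 2 * a k ∣ y - v k)) := by
      intro i hi
      by_cases hik : i = k
      · subst hik; simp
      · have := congrFun hxy ⟨i, by simp [hi, hik]⟩
        simpa [f] using this
    have hdeg : ∀ i, i ∈ I → 2 * a i ∣ 2 * v i := by
      intro i hi
      rcases (Finset.mem_filter.1 hi).2 with h | h <;> simp [h]
    have hsame : ∀ i, (2 * a i ∣ x - v i ↔ 2 * a i ∣ y - v i) → 2 * a i ∣ x - y := by
      intro i h
      by_cases hxi : 2 * a i ∣ x - v i
      · simpa using dvd_sub hxi (h.1 hxi)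
      · simpa using dvd_sub ((hx i).resolve_left hxi)
          ((hy i).resolve_left fun hyi => hxi (h.2 hyi))
    have hopp : ∀ i, ¬ (2 * a i ∣ x - v i ↔ 2 * a i ∣ y - v i) → 2 * a i ∣ x + y := by
      intro i h
      by_cases hxi : 2 * a i ∣ x - v i
      · have hyi := (hy i).resolve_left fun hyi => h (by tauto)
        have := dvd_add hxi hyi
        ring_nf at this ⊢
        exact this
      · have hyi : 2 * a i ∣ y - v i := by tauto
        have := dvd_add ((hx i).resolve_left hxi) hyi
        ring_nf at this ⊢
        exact this
    have hpos : ∀ i, i ∈ I → ∀ z, 2 * a i ∣ z - v i ∨ 2 * a i ∣ z + v i →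
        2 * a i ∣ z - v i := by
      rintro i hi z (h | h)
      · exact h
      · have := dvd_sub h (hdeg i hi)
        ring_nf at this ⊢
        exact this
    refine Subtype.ext (eq_of_two_mul_dvd_sub_or_add hL hx0 hxL hy0 hyL ?_)
    by_cases hkk : 2 * a k ∣ x - v k ↔ 2 * a k ∣ y - v k
    · refine Or.inl (two_mul_lcm_dvd fun i => hsame i ?_)
      by_cases hi : i ∈ I
      · exact iff_of_true (hpos i hi x (hx i)) (hpos i hi y (hy i))
      · have := hrel i hi
        tauto
    · refine Or.inr (two_mul_lcm_dvd fun i => ?_)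
      by_cases hi : i ∈ I
      · have := dvd_add (dvd_add (hpos i hi x (hx i)) (hpos i hi y (hy i))) (hdeg i hi)
        ring_nf at this ⊢
        exact this
      · have := hrel i hi
        exact hopp i (by tauto)
  have hcard := Nat.card_le_card_of_injective f hf
  have hexp : (Iᶜ.erase k).card = n - 1 - I.card := by
    rw [Finset.card_erase_of_mem hkI, Finset.card_compl, Fintype.card_fin]
    omega
  rwa [Nat.card_fun, Nat.card_eq_fintype_card (α := Bool), Fintype.card_bool,
    Nat.card_eq_fintype_card (α := Iᶜ.erase k), Fintype.card_coe, hexp] at hcard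
end

section
/- Assume a_1, …, a_n are pairwise coprime, and let 0 ≤ k ≤ n. Let b_k be the number of points v of the box with |I(v)| = k and M(v) > 0. Then 2^{n−1} · b_k = 2^k · Σ_{J ⊆ {1,…,n}, |J| = k} Π_{j ∈ {1,…,n} \ J} (a_j − 1). -/
/-- A periodic condition invariant under negation that has an integer solution has one in
the half period `[0, L]`. -/
theorem exists_mem_half_period {P : ℤ → Prop} {L : ℤ} (hL : 0 < L)
    (hper : ∀ x c, P x → P (x + 2 * L * c)) (hneg : ∀ x, P x → P (-x)) {x : ℤ} (hx : P x) :
    ∃ y, 0 ≤ y ∧ y ≤ L ∧ P y := by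
  have hmod : P (x % (2 * L)) := by
    have h := hper x (-(x / (2 * L))) hx
    rwa [show x + 2 * L * -(x / (2 * L)) = x % (2 * L) by
      have := Int.emod_add_mul_ediv x (2 * L); linarith] at h
  have h0 := Int.emod_nonneg x (show 2 * L ≠ 0 by omega)
  have h1 := Int.emod_lt_of_pos x (show 0 < 2 * L by omega)
  by_cases hle : x % (2 * L) ≤ L
  · exact ⟨_, h0, hle, hmod⟩
  · refine ⟨-(x % (2 * L)) + 2 * L * 1, by omega, by omega, hper _ _ (hneg _ hmod)⟩

theorem finset_lcm_pos {ι : Type*} (s : Finset ι) (a : ι → ℤ) (ha : ∀ i ∈ s, 0 < a i) :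
    0 < s.lcm a := by
  have h0 : 0 ≤ s.lcm a := Int.nonneg_of_normalize_eq_self Finset.normalize_lcm
  have h1 : s.lcm a ≠ 0 := by
    rw [Ne, Finset.lcm_eq_zero_iff]
    rintro ⟨i, hi, h⟩
    exact (ha i hi).ne' h
  omega

theorem crossingNumber_pos_iff_exists (n : ℕ) (a v : Fin n → ℤ) :
    0 < crossingNumber n a v ↔ ∃ x : ℤ, 0 ≤ x ∧ x ≤ Finset.univ.lcm a ∧
      ∀ i, 2 * a i ∣ x - v i ∨ 2 * a i ∣ x + v i := by
  have hfin : Finite {x : ℤ // 0 ≤ x ∧ x ≤ Finset.univ.lcm a ∧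
      ∀ i : Fin n, 2 * a i ∣ x - v i ∨ 2 * a i ∣ x + v i} :=
    ((Set.finite_Icc 0 (Finset.univ.lcm a)).subset fun x hx => ⟨hx.1, hx.2.1⟩).to_subtype
  rw [crossingNumber, Nat.card_pos_iff, and_iff_left hfin, nonempty_subtype]

/-- For pairwise coprime side lengths, a point is hit exactly when its coordinates all have
the same parity. -/
theorem crossingNumber_pos_iff_parity {n : ℕ} {a : Fin n → ℤ} (ha : ∀ i, 0 < a i)
    (hcop : ∀ i j, i ≠ j → IsCoprime (a i) (a j)) (v : Fin n → ℤ) :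
    0 < crossingNumber n a v ↔ (∀ i, Even (v i)) ∨ ∀ i, ¬ Even (v i) := by
  rw [crossingNumber_pos_iff_exists]
  constructor
  · rintro ⟨x, -, -, hx⟩
    have hpar : ∀ i, Even (v i) ↔ Even x := by
      intro i
      have h2 : (2 : ℤ) ∣ x - v i ∨ (2 : ℤ) ∣ x + v i :=
        (hx i).imp (dvd_trans (dvd_mul_right _ _)) (dvd_trans (dvd_mul_right _ _))
      rw [Int.even_iff, Int.even_iff]
      omega
    by_cases hxe : Even x
    · exact Or.inl fun i => (hpar i).2 hxe
    · exact Or.inr fun i h => hxe ((hpar i).1 h)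
  · intro h
    obtain ⟨r, u, hu⟩ : ∃ (r : ℤ) (u : Fin n → ℤ), ∀ i, v i = r + 2 * u i := by
      rcases h with h | h
      · refine ⟨0, fun i => v i / 2, fun i => ?_⟩
        have := Int.even_iff.1 (h i)
        dsimp only
        omega
      · refine ⟨1, fun i => v i / 2, fun i => ?_⟩
        have := Int.not_even_iff.1 (h i)
        dsimp only
        omega
    obtain ⟨y, hy⟩ := Ideal.exists_forall_sub_mem_ideal       (I := fun i => Ideal.span {a i})
      (fun i j hij => (Ideal.isCoprime_span_singleton_iff _ _).2 (hcop i j hij)) u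
    refine exists_mem_half_period
      (P := fun x => ∀ i, 2 * a i ∣ x - v i ∨ 2 * a i ∣ x + v i)
      (finset_lcm_pos _ a fun i _ => ha i) ?_ ?_ (x := r + 2 * y) ?_
    · intro x c hx i
      have hd : 2 * a i ∣ 2 * Finset.univ.lcm a * c :=
        (mul_dvd_mul_left 2 (Finset.dvd_lcm (Finset.mem_univ i))).mul_right c
      refine (hx i).imp (fun h => ?_) fun h => ?_
      · simpa [add_sub_right_comm] using dvd_add h hd
      · simpa [add_right_comm] using dvd_add h hd
    · intro x hx i
      refine (hx i).symm.imp (fun h => ?_) fun h => ?_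
      · rwa [show -x - v i = -(x + v i) by ring, dvd_neg]
      · rwa [show -x + v i = -(x - v i) by ring, dvd_neg]
    · intro i
      left
      rw [hu i, show r + 2 * y - (r + 2 * u i) = 2 * (y - u i) by ring]
      exact mul_dvd_mul_left 2 (Ideal.mem_span_singleton.1 (hy i))

/-- The end points of the segment `[0, a]` if `p` holds, and its interior points otherwise. -/
noncomputable def segmentPart (a : ℤ) (p : Prop) [Decidable p] : Finset ℤ :=
  if p then {0, a} else Finset.Ioo 0 a

theorem mem_segmentPart {a : ℤ} (ha : 0 < a) {p : Prop} [Decidable p] {x : ℤ} :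
    x ∈ segmentPart a p ↔ (0 ≤ x ∧ x ≤ a) ∧ ((x = 0 ∨ x = a) ↔ p) := by
  unfold segmentPart
  split_ifs with h
  · simp only [Finset.mem_insert, Finset.mem_singleton, h, iff_true]
    omega
  · simp only [Finset.mem_Ioo, h, iff_false]
    omega

theorem card_segmentPart {a : ℤ} (ha : 0 < a) (p : Prop) [Decidable p] :
    ((segmentPart a p).card : ℤ) = if p then 2 else a - 1 := by
  unfold segmentPart
  split_ifs with h
  · rw [Finset.card_pair ha.ne]; rfl
  · rw [Int.card_Ioo]; omega

theorem card_filter_even_segmentPart_of_odd {a : ℤ} (ha : 0 < a) (hodd : Odd a)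
    (p : Prop) [Decidable p] :
    ((segmentPart a p).filter fun x => Even x).card =
      ((segmentPart a p).filter fun x => ¬ Even x).card := by
  have hodd' := Int.odd_iff.1 hodd
  refine Finset.card_nbij' (fun x => a - x) (fun x => a - x) ?_ ?_
    (fun x _ => sub_sub_cancel a x) fun x _ => sub_sub_cancel a x
  all_goals
    intro x hx
    simp only [Finset.coe_filter, Set.mem_ofPred_eq, mem_segmentPart ha, Int.even_iff] at hx ⊢
    obtain ⟨⟨h1, h2⟩, h3⟩ := hx
    refine ⟨⟨by omega, ?_⟩, by omega⟩
    rw [← h2]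
    omega

/-- Among pairwise coprime integers at most one is even. -/
theorem exists_forall_ne_odd {ι : Type*} [Nonempty ι] {a : ι → ℤ}
    (hcop : ∀ i j, i ≠ j → IsCoprime (a i) (a j)) : ∃ m, ∀ i, i ≠ m → Odd (a i) := by
  by_cases h : ∃ m, Even (a m)
  · obtain ⟨m, hm⟩ := h
    refine ⟨m, fun i hi => ?_⟩
    by_contra hne
    have hunit := (hcop i m hi).isUnit_of_dvd' (Int.not_odd_iff_even.1 hne).two_dvd hm.two_dvd
    exact absurd (Int.isUnit_iff.1 hunit) (by decide)
  · push Not at h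
    exact ⟨Classical.arbitrary ι, fun i _ => Int.not_even_iff_odd.1 (h i)⟩

theorem two_pow_mul_prod_add_prod {ι : Type*} [Fintype ι] [DecidableEq ι] {c d : ι → ℤ} (m : ι)
    (h : ∀ i, i ≠ m → c i = d i) :
    2 ^ (Fintype.card ι - 1) * (∏ i, c i + ∏ i, d i) = ∏ i, (c i + d i) := by
  have hm := Finset.mem_univ m
  have hd : ∏ i ∈ Finset.univ.erase m, d i = ∏ i ∈ Finset.univ.erase m, c i :=
    Finset.prod_congr rfl fun i hi => (h i (Finset.ne_of_mem_erase hi)).symm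
  have hs : ∏ i ∈ Finset.univ.erase m, (c i + d i) =
      2 ^ (Fintype.card ι - 1) * ∏ i ∈ Finset.univ.erase m, c i := by
    rw [← Finset.card_univ, ← Finset.card_erase_of_mem hm, ← Finset.prod_const,
      ← Finset.prod_mul_distrib]
    refine Finset.prod_congr rfl fun i hi => ?_
    rw [← h i (Finset.ne_of_mem_erase hi), two_mul]
  rw [← Finset.mul_prod_erase _ _ hm, ← Finset.mul_prod_erase _ d hm,
    ← Finset.mul_prod_erase _ (fun i => c i + d i) hm, hd, hs]
  ring

/-- The points of the box with boundary index set `J` whose coordinates all have the same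
parity. -/
noncomputable def sameParityPoints {n : ℕ} (a : Fin n → ℤ) (J : Finset (Fin n)) : Finset (Fin n → ℤ) :=
  (Fintype.piFinset fun i => (segmentPart (a i) (i ∈ J)).filter fun x => Even x) ∪
    Fintype.piFinset fun i => (segmentPart (a i) (i ∈ J)).filter fun x => ¬ Even x

theorem mem_sameParityPoints {n : ℕ} {a : Fin n → ℤ} (ha : ∀ i, 0 < a i) {J : Finset (Fin n)}
    {v : Fin n → ℤ} :
    v ∈ sameParityPoints a J ↔ (∀ i, 0 ≤ v i ∧ v i ≤ a i) ∧
      Finset.univ.filter (fun i => v i = 0 ∨ v i = a i) = J ∧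
      ((∀ i, Even (v i)) ∨ ∀ i, ¬ Even (v i)) := by
  simp only [sameParityPoints, Finset.mem_union, Fintype.mem_piFinset, Finset.mem_filter,
    mem_segmentPart (ha _), Finset.ext_iff, Finset.mem_univ, true_and, forall_and]
  tauto

theorem two_pow_mul_card_sameParityPoints {n : ℕ} (hn : 1 ≤ n) {a : Fin n → ℤ}
    (ha : ∀ i, 0 < a i) (hcop : ∀ i j, i ≠ j → IsCoprime (a i) (a j)) (J : Finset (Fin n)) :
    (2 ^ (n - 1) * (sameParityPoints a J).card : ℤ) =
      2 ^ J.card * ∏ j ∈ Finset.univ \ J, (a j - 1) := by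
  have hne : Nonempty (Fin n) := ⟨⟨0, hn⟩⟩
  obtain ⟨m, hm⟩ := exists_forall_ne_odd hcop
  have hdisj : Disjoint
      (Fintype.piFinset fun i => (segmentPart (a i) (i ∈ J)).filter fun x => Even x)
      (Fintype.piFinset fun i => (segmentPart (a i) (i ∈ J)).filter fun x => ¬ Even x) := by
    rw [Finset.disjoint_left]
    intro v h0 h1
    rw [Fintype.mem_piFinset] at h0 h1
    exact (Finset.mem_filter.1 (h1 m)).2 (Finset.mem_filter.1 (h0 m)).2
  have key := two_pow_mul_prod_add_prod
    (c := fun i => (((segmentPart (a i) (i ∈ J)).filter fun x => Even x).card : ℤ))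
    (d := fun i => (((segmentPart (a i) (i ∈ J)).filter fun x => ¬ Even x).card : ℤ)) m
    fun i hi => congrArg _ (card_filter_even_segmentPart_of_odd (ha i) (hm i hi) (i ∈ J))
  rw [Fintype.card_fin] at key
  rw [sameParityPoints, Finset.card_union_of_disjoint hdisj, Fintype.card_piFinset,
    Fintype.card_piFinset]
  push_cast
  rw [key]
  have hsum : ∀ i, (((segmentPart (a i) (i ∈ J)).filter fun x => Even x).card : ℤ) +
      ((segmentPart (a i) (i ∈ J)).filter fun x => ¬ Even x).card =
      if i ∈ J then 2 else a i - 1 := by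
    intro i
    rw [← card_segmentPart (ha i), ← Nat.cast_add, Finset.card_filter_add_card_filter_not]
  simp only [hsum]
  rw [Finset.prod_ite, Finset.prod_const]
  congr 2
  · simp
  · ext; simp

/-- For pairwise coprime side lengths and `0 ≤ k ≤ n`, the number `b_k` of points `v` of
the box with `|I(v)| = k` and `M(v) > 0` satisfies
`2^(n-1) * b_k = 2^k * ∑_{J ⊆ [n], |J| = k} ∏_{j ∉ J} (a j - 1)`. -/
theorem card_bouncing_points (n : ℕ) (hn : 1 ≤ n)
    (a : Fin n → ℤ) (ha : ∀ i, 0 < a i)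
    (hcop : ∀ i j, i ≠ j → IsCoprime (a i) (a j))
    (k : ℕ) (hk : k ≤ n)
    (b : ℕ)
    (hb : b = Nat.card {v : Fin n → ℤ // (∀ i, 0 ≤ v i ∧ v i ≤ a i) ∧
      (Finset.univ.filter (fun i => v i = 0 ∨ v i = a i)).card = k ∧
      0 < crossingNumber n a v}) :
    (2 ^ (n - 1) * b : ℤ) =
      2 ^ k * ∑ J ∈ Finset.powersetCard k (Finset.univ : Finset (Fin n)),
        ∏ j ∈ Finset.univ \ J, (a j - 1) := by
  have hcard : b = ∑ J ∈ Finset.powersetCard k Finset.univ, (sameParityPoints a J).card := by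
    rw [← Finset.card_biUnion, hb]
    · refine Nat.subtype_card _ fun v => ?_
      simp only [Finset.mem_biUnion, Finset.mem_powersetCard, Finset.subset_univ, true_and,
        mem_sameParityPoints ha, crossingNumber_pos_iff_parity ha hcop]
      constructor
      · rintro ⟨J, hJ, hbox, rfl, hpar⟩
        exact ⟨hbox, hJ, hpar⟩
      · rintro ⟨hbox, hJ, hpar⟩
        exact ⟨_, hJ, hbox, rfl, hpar⟩
    · intro J _ K _ hJK
      refine Finset.disjoint_left.2 fun v hJ hK => hJK ?_
      rw [mem_sameParityPoints ha] at hJ hK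
      exact hJ.2.1.symm.trans hK.2.1
  rw [hcard]
  push_cast
  rw [Finset.mul_sum, Finset.mul_sum]
  refine Finset.sum_congr rfl fun J hJ => ?_
  rw [two_pow_mul_card_sameParityPoints hn ha hcop J, (Finset.mem_powersetCard.1 hJ).2]
end

section
/- The sum, over all points v of the box, of the number of integers x with 1 ≤ x ≤ ℓ such that for every i ∈ {1,…,n} either 2a_i ∣ (x − v_i) or 2a_i ∣ (x + v_i), equals ℓ. -/
/-- Every integer is congruent up to sign, modulo `2 * a`, to exactly one integer of `[0, a]`. -/
theorem existsUnique_mem_Icc_two_mul_dvd_sub_or_add {a : ℤ} (ha : 0 < a) (x : ℤ) :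
    ∃! v : ℤ, (0 ≤ v ∧ v ≤ a) ∧ (2 * a ∣ x - v ∨ 2 * a ∣ x + v) := by
  have h2a : 0 < 2 * a := by omega
  apply existsUnique_of_exists_of_unique
  · have hnonneg := Int.emod_nonneg x h2a.ne'
    have hlt := Int.emod_lt_of_pos x h2a
    have hdvd : 2 * a ∣ x - x % (2 * a) := Int.dvd_self_sub_emod
    by_cases hle : x % (2 * a) ≤ a
    · exact ⟨x % (2 * a), ⟨hnonneg, hle⟩, Or.inl hdvd⟩
    · refine ⟨2 * a - x % (2 * a), ⟨by omega, by omega⟩, Or.inr ?_⟩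
      have := dvd_add hdvd (dvd_refl (2 * a))
      rwa [show x - x % (2 * a) + 2 * a = x + (2 * a - x % (2 * a)) by ring] at this
  · rintro v w ⟨⟨hv0, hva⟩, hv⟩ ⟨⟨hw0, hwa⟩, hw⟩
    have hvw : 2 * a ∣ v - w ∨ 2 * a ∣ v + w := by
      rcases hv with hv | hv <;> rcases hw with hw | hw
      · exact .inl (by simpa using dvd_sub hw hv)
      · exact .inr (by simpa [add_comm] using dvd_sub hw hv)
      · exact .inr (by simpa using dvd_sub hv hw)
      · exact .inl (by simpa using dvd_sub hv hw)
    rcases hvw with hdvd | hdvd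
    · have := Int.eq_zero_of_abs_lt_dvd hdvd (by rw [abs_lt]; omega)
      omega
    · rcases (show 0 ≤ v + w by omega).eq_or_lt with hzero | hpos
      · omega
      · have := Int.le_of_dvd hpos hdvd
        omega

/-- Summing over all points `v` of the box the number of integers `x` with `1 ≤ x ≤ ℓ`
such that for every `i`, `2 * a i ∣ x - v i` or `2 * a i ∣ x + v i`, gives exactly
`ℓ = lcm (a 1, …, a n)`. -/
theorem sum_crossings_eq_lcm (n : ℕ) (hn : 1 ≤ n)
    (a : Fin n → ℤ) (ha : ∀ i, 0 < a i) :
    (∑ v ∈ Finset.Icc (0 : Fin n → ℤ) a,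
      Nat.card {x : ℤ // 1 ≤ x ∧ x ≤ Finset.univ.lcm a ∧
        ∀ i : Fin n, 2 * a i ∣ x - v i ∨ 2 * a i ∣ x + v i} : ℤ) =
      Finset.univ.lcm a := by
  classical
  have hnonneg : 0 ≤ Finset.univ.lcm a :=
    Int.nonneg_of_normalize_eq_self Finset.normalize_lcm
  generalize Finset.univ.lcm a = L at hnonneg ⊢
  let crosses (v : Fin n → ℤ) (x : ℤ) : Prop :=
    ∀ i, 2 * a i ∣ x - v i ∨ 2 * a i ∣ x + v i
  have hcard (v : Fin n → ℤ) : Nat.card {x : ℤ // 1 ≤ x ∧ x ≤ L ∧ crosses v x} =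
      ((Finset.Icc 1 L).bipartiteAbove crosses v).card := by
    apply Nat.subtype_card
    simp [Finset.mem_bipartiteAbove, and_assoc]
  have hone (x : ℤ) : ((Finset.Icc 0 a).bipartiteBelow crosses x).card = 1 := by
    choose v hv huniq using fun i ↦ existsUnique_mem_Icc_two_mul_dvd_sub_or_add (ha i) x
    refine Finset.card_eq_one.mpr ⟨v, Finset.eq_singleton_iff_unique_mem.mpr ⟨?_, ?_⟩⟩
    · rw [Finset.mem_bipartiteBelow, Finset.mem_Icc]
      exact ⟨⟨fun i ↦ (hv i).1.1, fun i ↦ (hv i).1.2⟩, fun i ↦ (hv i).2⟩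
    · intro w hw
      rw [Finset.mem_bipartiteBelow, Finset.mem_Icc] at hw
      exact funext fun i ↦ huniq i (w i) ⟨⟨hw.1.1 i, hw.1.2 i⟩, hw.2 i⟩
  change ∑ v ∈ Finset.Icc 0 a, (Nat.card {x : ℤ // 1 ≤ x ∧ x ≤ L ∧ crosses v x} : ℤ) = L
  rw [← Nat.cast_sum, Finset.sum_congr rfl fun v _ ↦ hcard v,
    Finset.sum_card_bipartiteAbove_eq_sum_card_bipartiteBelow,
    Finset.sum_congr rfl fun x _ ↦ hone x]
  simp [hnonneg]
end

section
/- Let v be a point of the box that is not a corner. Then #{x ∈ ℤ : 0 ≤ x < 2ℓ and for every i ∈ {1,…,n}, 2a_i ∣ (x − v_i) or 2a_i ∣ (x + v_i)} = 2 · M(v). -/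
/-- A predicate on `ℤ` that is symmetric under `x ↦ 2 * L - x` and fails at `0` and `L` has
twice as many solutions in `[0, 2 * L)` as in `[0, L]`. -/
theorem Int.card_subtype_lt_two_mul_of_symm (P : ℤ → Prop) (L : ℤ)
    (hsymm : ∀ x, P x → P (2 * L - x)) (hzero : ¬ P 0) (hL : ¬ P L) :
    Nat.card {x : ℤ // 0 ≤ x ∧ x < 2 * L ∧ P x} =
      2 * Nat.card {x : ℤ // 0 ≤ x ∧ x ≤ L ∧ P x} := by
  classical
  have hcard : Nat.card {x : ℤ // 0 ≤ x ∧ x ≤ L ∧ P x} =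
      ((Finset.Icc 0 L).filter P).card :=
    Nat.subtype_card _ fun x => by simp [and_assoc]
  have hcard_two : Nat.card {x : ℤ // 0 ≤ x ∧ x < 2 * L ∧ P x} =
      ((Finset.Ico 0 (2 * L)).filter P).card :=
    Nat.subtype_card _ fun x => by simp [and_assoc]
  have hunion : (Finset.Ico 0 (2 * L)).filter P =
      (Finset.Icc 0 L).filter P ∪ ((Finset.Icc 0 L).filter P).image (2 * L - ·) := by
    ext x
    simp only [Finset.mem_union, Finset.mem_image, Finset.mem_filter, Finset.mem_Icc,
      Finset.mem_Ico]
    constructor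
    · rintro ⟨⟨h0, h2⟩, hx⟩
      rcases le_total x L with h | h
      · exact Or.inl ⟨⟨h0, h⟩, hx⟩
      · exact Or.inr ⟨2 * L - x, ⟨⟨by omega, by omega⟩, hsymm x hx⟩, by omega⟩
    · rintro (⟨⟨h0, h1⟩, hx⟩ | ⟨y, ⟨⟨h0, h1⟩, hy⟩, rfl⟩)
      · have : x ≠ 0 := fun h => hzero (h ▸ hx)
        exact ⟨⟨h0, by omega⟩, hx⟩
      · have : y ≠ 0 := fun h => hzero (h ▸ hy)
        exact ⟨⟨by omega, by omega⟩, hsymm y hy⟩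
  have hdisj : Disjoint ((Finset.Icc 0 L).filter P)
      (((Finset.Icc 0 L).filter P).image (2 * L - ·)) := by
    rw [Finset.disjoint_left]
    simp only [Finset.mem_image, Finset.mem_filter, Finset.mem_Icc]
    rintro x ⟨⟨h0, h1⟩, hx⟩ ⟨y, ⟨⟨h2, h3⟩, hy⟩, rfl⟩
    have hyL : y = L := by omega
    exact hL (hyL ▸ hy)
  rw [hcard, hcard_two, hunion, Finset.card_union_of_disjoint hdisj,
    Finset.card_image_of_injective _ sub_right_injective, two_mul]

/-- A box coordinate met at a time divisible by the side length lies on the boundary. -/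
theorem Int.eq_zero_or_eq_of_two_mul_dvd {a v x : ℤ} (hv : 0 ≤ v ∧ v ≤ a)
    (hax : a ∣ x) (hx : 2 * a ∣ x - v ∨ 2 * a ∣ x + v) : v = 0 ∨ v = a := by
  have hav : a ∣ v := by
    rcases hx with h | h
    · exact (dvd_sub_right hax).1 (dvd_of_mul_left_dvd h)
    · exact (dvd_add_right hax).1 (dvd_of_mul_left_dvd h)
  rcases hv.1.eq_or_lt with h | h
  · exact Or.inl h.symm
  · exact Or.inr (le_antisymm hv.2 (Int.le_of_dvd h hav))

/-- For a non-corner point `v` of the box, the number of integers `x` with `0 ≤ x < 2ℓ`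
satisfying the divisibility conditions is twice the crossing number. -/
theorem card_solutions_lt_two_lcm (n : ℕ) (hn : 1 ≤ n)
    (a : Fin n → ℤ) (ha : ∀ i, 0 < a i)
    (v : Fin n → ℤ) (hv : ∀ i, 0 ≤ v i ∧ v i ≤ a i)
    (hnotcorner : ¬ ∀ i, v i = 0 ∨ v i = a i) :
    Nat.card {x : ℤ // 0 ≤ x ∧ x < 2 * Finset.univ.lcm a ∧
      ∀ i : Fin n, 2 * a i ∣ x - v i ∨ 2 * a i ∣ x + v i} =
    2 * crossingNumber n a v := by
  have hnot : ∀ x : ℤ, (∀ i, a i ∣ x) →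
      ¬ ∀ i : Fin n, 2 * a i ∣ x - v i ∨ 2 * a i ∣ x + v i := fun x hx h =>
    hnotcorner fun i => Int.eq_zero_or_eq_of_two_mul_dvd (hv i) (hx i) (h i)
  have hdvd : ∀ i, a i ∣ Finset.univ.lcm a := fun i => Finset.dvd_lcm (Finset.mem_univ i)
  refine Int.card_subtype_lt_two_mul_of_symm _ _ (fun x hx i => ?_)
    (hnot 0 fun i => dvd_zero _) (hnot _ hdvd)
  have h2 : 2 * a i ∣ 2 * Finset.univ.lcm a := mul_dvd_mul_left 2 (hdvd i)
  rcases hx i with h | h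
  · right
    simpa [sub_sub_eq_add_sub, sub_add] using dvd_sub h2 h
  · left
    simpa [sub_sub] using dvd_sub h2 h
end

section
/- Assume a_1, …, a_n are pairwise coprime. Let v be a point of the box that is not a corner and whose coordinates all have the same parity (all v_i even or all v_i odd). Then M(v) > 0. -/
/-- Integers of a common parity `p` can be simultaneously congruent to a single integer modulo
the doubles of pairwise coprime moduli. -/
lemma exists_two_mul_dvd_sub_of_emod_two_eq {ι : Type*} [Finite ι] {a v : ι → ℤ} {p : ℤ}
    (hcop : ∀ i j, i ≠ j → IsCoprime (a i) (a j)) (hp : ∀ i, v i % 2 = p) :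
    ∃ x, ∀ i, 2 * a i ∣ x - v i := by
  obtain ⟨y, hy⟩ := Ideal.exists_forall_sub_mem_ideal (I := fun i ↦ Ideal.span {a i})
    (fun i j hij ↦ (Ideal.isCoprime_span_singleton_iff _ _).2 (hcop i j hij)) (fun i ↦ v i / 2)
  refine ⟨p + 2 * y, fun i ↦ ?_⟩
  have h : p + 2 * y - v i = 2 * (y - v i / 2) := by
    have := hp i
    omega
  rw [h]
  exact mul_dvd_mul_left 2 (Ideal.mem_span_singleton.1 (hy i))

/-- An integer can be folded into `[0, L]` by translations by `2 * L` and a reflection. -/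
lemma exists_mem_Icc_two_mul_dvd_sub_or_add {L : ℤ} (hL : 0 < L) (x : ℤ) :
    ∃ y, 0 ≤ y ∧ y ≤ L ∧ (2 * L ∣ y - x ∨ 2 * L ∣ y + x) := by
  have h0 := Int.emod_nonneg x (show 2 * L ≠ 0 by omega)
  have h1 := Int.emod_lt_of_pos x (show 0 < 2 * L by omega)
  have h2 := Int.emod_add_mul_ediv x (2 * L)
  by_cases h : x % (2 * L) ≤ L
  · exact ⟨x % (2 * L), h0, h, .inl ⟨-(x / (2 * L)), by linarith⟩⟩
  · exact ⟨2 * L - x % (2 * L), by omega, by omega, .inr ⟨1 + x / (2 * L), by linarith⟩⟩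

/-- For pairwise coprime side lengths, every non-corner point of the box whose
coordinates all have the same parity has positive crossing number. -/
theorem crossingNumber_pos_of_coprime (n : ℕ) (hn : 1 ≤ n)
    (a : Fin n → ℤ) (ha : ∀ i, 0 < a i)
    (hcop : ∀ i j, i ≠ j → IsCoprime (a i) (a j))
    (v : Fin n → ℤ) (hv : ∀ i, 0 ≤ v i ∧ v i ≤ a i)
    (hnotcorner : ¬ ∀ i, v i = 0 ∨ v i = a i)
    (hparity : (∀ i, v i % 2 = 0) ∨ (∀ i, v i % 2 = 1)) :
    0 < crossingNumber n a v := by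
  obtain ⟨x, hx⟩ : ∃ x, ∀ i, 2 * a i ∣ x - v i :=
    hparity.elim (exists_two_mul_dvd_sub_of_emod_two_eq hcop)
      (exists_two_mul_dvd_sub_of_emod_two_eq hcop)
  have hL : 0 < Finset.univ.lcm a := by
    refine lt_of_le_of_ne (Int.nonneg_iff_normalize_eq_self _ |>.1 Finset.normalize_lcm) ?_
    intro h
    obtain ⟨i, -, hi⟩ := Finset.lcm_eq_zero_iff.1 h.symm
    exact (ha i).ne' hi
  obtain ⟨y, hy0, hyL, hy⟩ := exists_mem_Icc_two_mul_dvd_sub_or_add hL x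
  have hfin : Finite {x : ℤ // 0 ≤ x ∧ x ≤ Finset.univ.lcm a ∧
      ∀ i : Fin n, 2 * a i ∣ x - v i ∨ 2 * a i ∣ x + v i} :=
    ((Set.finite_Icc 0 (Finset.univ.lcm a)).subset fun z hz ↦ ⟨hz.1, hz.2.1⟩).to_subtype
  refine Nat.card_pos_iff.2 ⟨⟨y, hy0, hyL, fun i ↦ ?_⟩, hfin⟩
  have hi : 2 * a i ∣ 2 * Finset.univ.lcm a :=
    mul_dvd_mul_left 2 (Finset.dvd_lcm (Finset.mem_univ i))
  refine hy.imp (fun h ↦ ?_) fun h ↦ ?_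
  · simpa using dvd_add (hi.trans h) (hx i)
  · exact (show y + x - (x - v i) = y + v i by ring) ▸ dvd_sub (hi.trans h) (hx i)
end
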